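/- arXiv:2507.15153 — 2 statements merged into one kernel-verified Lean document; each statement's English description precedes it below -/
import Mathlib

section
/- For any real number L with 0 ≤ L ≤ 1 and any ε > 0, there exists a finite group G such that |z_I(G) − L| < ε. -/
open scoped Classical

noncomputable section

/-- `z` is a (complex) root of unity. -/
def IsRootOfUnity (z : ℂ) : Prop := ∃ n : ℕ, 0 < n ∧ z ^ n = 1

/-- `χ` is an irreducible complex character of the group `G`, i.e. the character of some
simple (irreducible) finite-dimensional complex representation of `G`. -/
def IsIrredChar {G : Type} [Group G] (χ : G → ℂ) : Prop :=
  ∃ V : FDRep ℂ G, CategoryTheory.Simple V ∧ χ = V.character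

/-- `z_I(G)`: the proportion of pairs `(χ, g) ∈ Irr(G) × G` with `χ g = 0`. -/
def zIG (G : Type) [Group G] : ℝ :=
  (Nat.card {p : (G → ℂ) × G | IsIrredChar p.1 ∧ p.1 p.2 = 0} : ℝ) /
    ((Nat.card {χ : G → ℂ | IsIrredChar χ} : ℝ) * (Nat.card G : ℝ))

/-- `u_I(G)`: the proportion of pairs `(χ, g) ∈ Irr(G) × G` with `χ g` a root of unity. -/
def uIG (G : Type) [Group G] : ℝ :=
  (Nat.card {p : (G → ℂ) × G | IsIrredChar p.1 ∧ IsRootOfUnity (p.1 p.2)} : ℝ) /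
    ((Nat.card {χ : G → ℂ | IsIrredChar χ} : ℝ) * (Nat.card G : ℝ))

/-- `θ(G)`: the proportion of pairs `(χ, g) ∈ Irr(G) × G` with `χ g` zero or a root of
unity. -/
def thetaG (G : Type) [Group G] : ℝ :=
  (Nat.card {p : (G → ℂ) × G |
      IsIrredChar p.1 ∧ (p.1 p.2 = 0 ∨ IsRootOfUnity (p.1 p.2))} : ℝ) /
    ((Nat.card {χ : G → ℂ | IsIrredChar χ} : ℝ) * (Nat.card G : ℝ))

/-- `z_II(G)`: the proportion of pairs `(χ, C) ∈ Irr(G) × Cl(G)` such that `χ` vanishes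
on the conjugacy class `C`. -/
def zIIG (G : Type) [Group G] : ℝ :=
  (Nat.card {p : (G → ℂ) × ConjClasses G |
      IsIrredChar p.1 ∧ ∀ g ∈ p.2.carrier, p.1 g = 0} : ℝ) /
    ((Nat.card {χ : G → ℂ | IsIrredChar χ} : ℝ) * (Nat.card (ConjClasses G) : ℝ))

/-- `u_II(G)`: the proportion of pairs `(χ, gᴳ) ∈ Irr(G) × Cl(G)` with `χ g` a root of
unity. -/
def uIIG (G : Type) [Group G] : ℝ :=
  (Nat.card {p : (G → ℂ) × ConjClasses G |
      IsIrredChar p.1 ∧ ∃ g, ConjClasses.mk g = p.2 ∧ IsRootOfUnity (p.1 g)} : ℝ) /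
    ((Nat.card {χ : G → ℂ | IsIrredChar χ} : ℝ) * (Nat.card (ConjClasses G) : ℝ))

/-- `θ_II(G)`: the proportion of pairs `(χ, gᴳ) ∈ Irr(G) × Cl(G)` with `χ g` zero or a
root of unity. -/
def thetaIIG (G : Type) [Group G] : ℝ :=
  (Nat.card {p : (G → ℂ) × ConjClasses G |
      IsIrredChar p.1 ∧ ∃ g, ConjClasses.mk g = p.2 ∧
        (p.1 g = 0 ∨ IsRootOfUnity (p.1 g))} : ℝ) /
    ((Nat.card {χ : G → ℂ | IsIrredChar χ} : ℝ) * (Nat.card (ConjClasses G) : ℝ))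

/-- `f` is the character of some finite-dimensional complex representation of `G`. -/
def IsCharacter {G : Type} [Group G] (f : G → ℂ) : Prop :=
  ∃ V : FDRep ℂ G, V.character = f

lemma isCharacter_of_representation {G V : Type} [Group G] [AddCommGroup V] [Module ℂ V]
    [Module.Finite ℂ V] (ρ : Representation ℂ G V) : IsCharacter fun g => (ρ g).trace ℂ V :=
  ⟨FDRep.of ρ, rfl⟩

lemma isCharacter_of_monoidHom {G : Type} [Group G] (f : G →* ℂ) : IsCharacter f := by
  let ρ : Representation ℂ G ℂ :=
    { toFun := fun g => f g • LinearMap.id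
      map_one' := by simp; rfl
      map_mul' := fun g h => by ext; simp [mul_comm] }
  convert! isCharacter_of_representation ρ using 1
  ext g
  simp [ρ]

lemma IsCharacter.comp {G H : Type} [Group G] [Group H] {f : G → ℂ} (hf : IsCharacter f)
    (φ : H →* G) : IsCharacter (f ∘ φ) := by
  obtain ⟨V, rfl⟩ := hf
  exact isCharacter_of_representation (V.ρ.comp φ : Representation ℂ H V)

lemma IsCharacter.mul {G : Type} [Group G] {f₁ f₂ : G → ℂ} (h₁ : IsCharacter f₁)
    (h₂ : IsCharacter f₂) : IsCharacter (f₁ * f₂) := by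
  obtain ⟨V, rfl⟩ := h₁
  obtain ⟨W, rfl⟩ := h₂
  exact ⟨CategoryTheory.MonoidalCategoryStruct.tensorObj V W, FDRep.char_tensor V W⟩

/-- An orthonormal family of characters of `G` decomposing the regular character. Such a family
is a complete list without repetition of the irreducible characters of `G`. -/
structure IsCharacterTable {G ι : Type} [Group G] [Fintype G] [Fintype ι] (χ : ι → G → ℂ) :
    Prop where
  isCharacter : ∀ i, IsCharacter (χ i)
  orthonormal : ∀ i j, ∑ g, χ i g * χ j g⁻¹ = if i = j then (Fintype.card G : ℂ) else 0
  regular : ∀ g, ∑ i, χ i 1 * χ i g = if g = 1 then (Fintype.card G : ℂ) else 0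

namespace IsCharacterTable

variable {G H ι κ : Type} [Group G] [Fintype G] [Group H] [Fintype H] [Fintype ι] [Fintype κ]
  {χ : ι → G → ℂ} {ψ : κ → H → ℂ}

lemma injective (hχ : IsCharacterTable χ) : Function.Injective χ := by
  intro i j hij
  by_contra hne
  have h₁ := hχ.orthonormal i i
  have h₂ := hχ.orthonormal i j
  rw [← hij, if_neg hne] at h₂
  simp [h₂, eq_comm] at h₁

lemma isIrredChar (hχ : IsCharacterTable χ) (i : ι) : IsIrredChar (χ i) := by
  obtain ⟨V, hV⟩ := hχ.isCharacter i
  refine ⟨V, V.simple_iff_char_is_norm_one.mpr ?_, hV.symm⟩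
  rw [hV, hχ.orthonormal i i, if_pos rfl, Nat.card_eq_fintype_card]

lemma mem_range (hχ : IsCharacterTable χ) {f : G → ℂ} (hf : IsIrredChar f) :
    f ∈ Set.range χ := by
  obtain ⟨V, hV, rfl⟩ := hf
  by_contra hmem
  have : Invertible (Nat.card G : ℂ) := invertibleOfNonzero (NeZero.ne _)
  have horth (i : ι) : ∑ g, V.character g * χ i g⁻¹ = 0 := by
    obtain ⟨W, hW, hWχ⟩ := hχ.isIrredChar i
    have h := FDRep.char_orthonormal V W
    rw [if_neg, mul_eq_zero] at h
    · rw [hWχ]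
      exact h.resolve_left (inv_ne_zero (NeZero.ne _))
    · rintro ⟨e⟩
      exact hmem ⟨i, by rw [hWχ, FDRep.char_iso e]⟩
  have hdim : V.character 1 = 0 := by
    have h : ∑ g, V.character g * ∑ i, χ i 1 * χ i g⁻¹ = 0 := by
      simp_rw [Finset.mul_sum]
      rw [Finset.sum_comm]
      refine Finset.sum_eq_zero fun i _ => ?_
      rw [← mul_zero (χ i 1), ← horth i, Finset.mul_sum]
      exact Finset.sum_congr rfl fun g _ => by ring
    simpa [hχ.regular] using h
  have hnorm := V.simple_iff_char_is_norm_one.mp hV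
  rw [FDRep.char_one, Nat.cast_eq_zero] at hdim
  have : Subsingleton V := Module.finrank_zero_iff.mp hdim
  have hzero (g : G) : V.character g = 0 := by
    rw [FDRep.character, Subsingleton.elim (V.ρ g) 0, map_zero]
  simp [hzero, eq_comm] at hnorm

lemma zIG_eq (hχ : IsCharacterTable χ) :
    zIG G = (Nat.card {x : ι × G | χ x.1 x.2 = 0} : ℝ) / (Nat.card ι * Nat.card G) := by
  have hirr : {f : G → ℂ | IsIrredChar f} = Set.range χ :=
    Set.Subset.antisymm (fun _ => hχ.mem_range) (Set.range_subset_iff.mpr hχ.isIrredChar)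
  have hzero : {p : (G → ℂ) × G | IsIrredChar p.1 ∧ p.1 p.2 = 0} =
      Prod.map χ id '' {x : ι × G | χ x.1 x.2 = 0} := by
    ext ⟨f, g⟩
    constructor
    · rintro ⟨hf, hfg⟩
      obtain ⟨i, rfl⟩ := hχ.mem_range hf
      exact ⟨(i, g), hfg, rfl⟩
    · rintro ⟨⟨i, g⟩, hig, h⟩
      obtain ⟨rfl, rfl⟩ := Prod.mk.inj h
      exact ⟨hχ.isIrredChar i, hig⟩
  rw [zIG, hirr, hzero, Nat.card_range_of_injective hχ.injective,
    Nat.card_image_of_injective (hχ.injective.prodMap Function.injective_id)]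

lemma one_sub_zIG_eq (hχ : IsCharacterTable χ) [Nonempty ι] :
    1 - zIG G = (Nat.card {x : ι × G | χ x.1 x.2 ≠ 0} : ℝ) / (Nat.card ι * Nat.card G) := by
  have h : Nat.card {x : ι × G | χ x.1 x.2 = 0} + Nat.card {x : ι × G | χ x.1 x.2 ≠ 0} =
      Nat.card ι * Nat.card G := by
    rw [← Nat.card_prod]
    exact Set.ncard_add_ncard_compl {x : ι × G | χ x.1 x.2 = 0}
  have h' : (Nat.card {x : ι × G | χ x.1 x.2 = 0} : ℝ) +
      Nat.card {x : ι × G | χ x.1 x.2 ≠ 0} = Nat.card ι * Nat.card G := by exact_mod_cast h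
  have hpos : (0 : ℝ) < Nat.card ι * Nat.card G := by
    exact_mod_cast Nat.mul_pos Nat.card_pos Nat.card_pos
  rw [hχ.zIG_eq, eq_div_iff hpos.ne', sub_mul, div_mul_cancel₀ _ hpos.ne']
  linarith

lemma prod (hχ : IsCharacterTable χ) (hψ : IsCharacterTable ψ) :
    IsCharacterTable fun (i : ι × κ) (g : G × H) => χ i.1 g.1 * ψ i.2 g.2 where
  isCharacter i := ((hχ.isCharacter i.1).comp (MonoidHom.fst G H)).mul
    ((hψ.isCharacter i.2).comp (MonoidHom.snd G H))
  orthonormal i j := by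
    have h := congrArg₂ (· * ·) (hχ.orthonormal i.1 j.1) (hψ.orthonormal i.2 j.2)
    simp only [Finset.sum_mul_sum, ← Fintype.sum_prod_type', ite_zero_mul_ite_zero] at h
    simp only [Fintype.card_prod, Nat.cast_mul, Prod.ext_iff, Prod.fst_inv, Prod.snd_inv]
    rw [← h]
    exact Finset.sum_congr rfl fun g _ => by ring
  regular g := by
    have h := congrArg₂ (· * ·) (hχ.regular g.1) (hψ.regular g.2)
    simp only [Finset.sum_mul_sum, ← Fintype.sum_prod_type', ite_zero_mul_ite_zero] at h
    simp only [Fintype.card_prod, Nat.cast_mul, Prod.ext_iff, Prod.fst_one, Prod.snd_one]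
    rw [← h]
    exact Finset.sum_congr rfl fun i _ => by ring

lemma one_sub_zIG_prod (hχ : IsCharacterTable χ) (hψ : IsCharacterTable ψ) [Nonempty ι]
    [Nonempty κ] : 1 - zIG (G × H) = (1 - zIG G) * (1 - zIG H) := by
  have hcard : Nat.card {x : (ι × κ) × G × H | χ x.1.1 x.2.1 * ψ x.1.2 x.2.2 ≠ 0} =
      Nat.card {x : ι × G | χ x.1 x.2 ≠ 0} * Nat.card {x : κ × H | ψ x.1 x.2 ≠ 0} := by
    rw [← Nat.card_prod]
    refine Nat.card_congr (((Equiv.prodProdProdComm ι κ G H).subtypeEquiv (q := fun y =>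
      χ y.1.1 y.1.2 ≠ 0 ∧ ψ y.2.1 y.2.2 ≠ 0) fun x => ?_).trans
        (Equiv.subtypeProdEquivProd (p := fun x : ι × G => χ x.1 x.2 ≠ 0)
          (q := fun x : κ × H => ψ x.1 x.2 ≠ 0)))
    exact mul_ne_zero_iff
  rw [(hχ.prod hψ).one_sub_zIG_eq, hχ.one_sub_zIG_eq, hψ.one_sub_zIG_eq, hcard, div_mul_div_comm]
  simp only [Nat.card_prod, Nat.cast_mul]
  congr 1
  ring

/-- Powers of `1 - zIG G` are again of this form. -/
lemma exists_one_sub_zIG_eq_pow (hχ : IsCharacterTable χ) [Nonempty ι] (n : ℕ) :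
    ∃ (K : Type) (_ : Group K) (_ : Fintype K) (μ : Type) (_ : Fintype μ) (_ : Nonempty μ)
      (φ : μ → K → ℂ), IsCharacterTable φ ∧ 1 - zIG K = (1 - zIG G) ^ n := by
  induction n with
  | zero =>
    have h : IsCharacterTable fun (_ : Unit) (_ : Unit) => (1 : ℂ) :=
      { isCharacter := fun _ => isCharacter_of_monoidHom (1 : Unit →* ℂ)
        orthonormal := by simp
        regular := by simp }
    exact ⟨Unit, inferInstance, inferInstance, Unit, inferInstance, inferInstance, _, h, by
      rw [h.one_sub_zIG_eq]; simp⟩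
  | succ n ih =>
    obtain ⟨K, _, _, μ, _, _, φ, hφ, h⟩ := ih
    exact ⟨K × G, inferInstance, inferInstance, μ × ι, inferInstance, inferInstance, _,
      hφ.prod hχ, by rw [hφ.one_sub_zIG_prod hχ, h, pow_succ]⟩

end IsCharacterTable

/-- The group of affine transformations `x ↦ scale * x + shift` of a commutative ring `R`. -/
@[ext]
structure AffineGroup (R : Type) [CommRing R] where
  scale : Rˣ
  shift : R

namespace AffineGroup

section CommRing

variable {R : Type} [CommRing R]

instance : Group (AffineGroup R) where
  mul g h := ⟨g.scale * h.scale, g.shift + g.scale * h.shift⟩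
  one := ⟨1, 0⟩
  inv g := ⟨g.scale⁻¹, -(↑g.scale⁻¹ * g.shift)⟩
  mul_assoc g h k := AffineGroup.ext (mul_assoc _ _ _) <| by
    change g.shift + g.scale * h.shift + ↑(g.scale * h.scale) * k.shift =
      g.shift + g.scale * (h.shift + h.scale * k.shift)
    push_cast
    ring
  one_mul g := AffineGroup.ext (one_mul _) <| by
    change 0 + ((1 : Rˣ) : R) * g.shift = g.shift
    simp
  mul_one g := AffineGroup.ext (mul_one _) <| by
    change g.shift + g.scale * 0 = g.shift
    simp
  inv_mul_cancel g := AffineGroup.ext (inv_mul_cancel _) <| by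
    change -(↑g.scale⁻¹ * g.shift) + ↑g.scale⁻¹ * g.shift = 0
    simp

@[simp] lemma scale_mul (g h : AffineGroup R) : (g * h).scale = g.scale * h.scale := rfl
@[simp] lemma shift_mul (g h : AffineGroup R) :
    (g * h).shift = g.shift + g.scale * h.shift := rfl
@[simp] lemma scale_one : (1 : AffineGroup R).scale = 1 := rfl
@[simp] lemma shift_one : (1 : AffineGroup R).shift = 0 := rfl
@[simp] lemma scale_inv (g : AffineGroup R) : g⁻¹.scale = g.scale⁻¹ := rfl
@[simp] lemma shift_inv (g : AffineGroup R) : g⁻¹.shift = -(↑g.scale⁻¹ * g.shift) := rfl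

/-- The linear part of an affine transformation. -/
def scaleHom : AffineGroup R →* Rˣ where
  toFun := scale
  map_one' := rfl
  map_mul' _ _ := rfl

/-- An affine transformation is given by its linear part and its translation part. -/
def equivProd : AffineGroup R ≃ Rˣ × R where
  toFun g := (g.scale, g.shift)
  invFun x := ⟨x.1, x.2⟩
  left_inv _ := rfl
  right_inv _ := rfl

instance [Fintype R] [Fintype Rˣ] : Fintype (AffineGroup R) := Fintype.ofEquiv _ equivProd.symm

lemma sum_eq [Fintype R] [Fintype Rˣ] (f : AffineGroup R → ℂ) : ∑ g, f g = ∑ a, ∑ b, f ⟨a, b⟩ := by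
  rw [← Fintype.sum_prod_type']
  exact Fintype.sum_equiv equivProd _ _ fun _ => rfl

/-- The monomial representation of the affine group on functions on the units, attached to an
additive character. -/
def monomialRep (e : AddChar R ℂ) : Representation ℂ (AffineGroup R) (Rˣ → ℂ) where
  toFun g :=
    { toFun := fun f x => e (x * g.shift) * f (x * g.scale)
      map_add' := fun f₁ f₂ => by ext x; simp [mul_add]
      map_smul' := fun c f => by ext x; simp; ring }
  map_one' := by ext; simp
  map_mul' g h := by
    refine LinearMap.ext fun f => funext fun x => ?_
    simp [mul_add, AddChar.map_add_eq_mul, mul_assoc]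

lemma trace_monomialRep [Fintype Rˣ] (e : AddChar R ℂ) (g : AffineGroup R) :
    (monomialRep e g).trace ℂ _ = if g.scale = 1 then ∑ x : Rˣ, e (x * g.shift) else 0 := by
  rw [LinearMap.trace_eq_matrix_trace ℂ (Pi.basisFun ℂ Rˣ), Matrix.trace]
  split_ifs with h
  · simp [monomialRep, h]
  · simp [monomialRep, h]

end CommRing

variable {p : ℕ} [Fact p.Prime]

lemma sum_zmod_eq (f : ZMod p → ℂ) : ∑ x, f x = f 0 + ∑ u : (ZMod p)ˣ, f u := by
  rw [Fintype.sum_eq_add_sum_subtype_ne f 0]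
  congr 1
  exact (Fintype.sum_equiv unitsEquivNeZero _ _ fun _ => rfl).symm

/-- The irreducible characters of the affine group of `ZMod p`: one of degree `p - 1`, and the
linear ones, given by Dirichlet characters. -/
def irr : Option (DirichletCharacter ℂ p) → AffineGroup (ZMod p) → ℂ
  | none, g => if g.scale = 1 then (if g.shift = 0 then (p : ℂ) - 1 else -1) else 0
  | some χ, g => χ g.scale

lemma isCharacter_irr (i : Option (DirichletCharacter ℂ p)) : IsCharacter (irr i) := by
  cases i with
  | some χ => exact isCharacter_of_monoidHom (χ.toMonoidHom.comp
      ((Units.coeHom _).comp scaleHom))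
  | none =>
    obtain ⟨e, he⟩ : ∃ e : AddChar (ZMod p) ℂ, e.IsPrimitive :=
      ⟨_, AddChar.zmodChar_primitive_of_primitive_root p
        (Complex.isPrimitiveRoot_exp p (NeZero.ne p))⟩
    convert! isCharacter_of_representation (monomialRep e) using 1
    ext g
    have hsum := AddChar.sum_mulShift g.shift he
    rw [trace_monomialRep, irr]
    rw [sum_zmod_eq, zero_mul, AddChar.map_zero_eq_one, ← eq_sub_iff_add_eq'] at hsum
    rw [hsum]
    split_ifs <;> simp

lemma card_eq : (Fintype.card (AffineGroup (ZMod p)) : ℂ) = (p - 1) * p := by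
  rw [Fintype.card_congr equivProd, Fintype.card_prod, ZMod.card_units, ZMod.card]
  push_cast [Nat.Prime.one_le (Fact.out : p.Prime)]
  rfl

lemma sum_irr_none_shift : ∑ b, irr (p := p) none ⟨1, b⟩ = 0 := by
  have h (b : ZMod p) : irr none ⟨1, b⟩ = (if b = 0 then (p : ℂ) else 0) - 1 := by
    rw [irr, if_pos rfl]
    split_ifs <;> simp
  simp [h]

lemma irr_none_inv (g : AffineGroup (ZMod p)) : irr none g⁻¹ = irr none g := by
  simp [irr, -ZMod.inv_coe_unit]

lemma irr_none_of_scale_ne_one {g : AffineGroup (ZMod p)} (hg : g.scale ≠ 1) :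
    irr none g = 0 :=
  if_neg hg

lemma sum_irr_none_mul (f : AffineGroup (ZMod p) → ℂ) :
    ∑ g, irr none g * f g = ∑ b, irr none ⟨1, b⟩ * f ⟨1, b⟩ := by
  rw [sum_eq, Finset.sum_eq_single 1 _ (by simp)]
  intro a _ ha
  exact Finset.sum_eq_zero fun b _ => by rw [irr_none_of_scale_ne_one ha, zero_mul]

lemma sum_irr_none_mul_irr_some (χ : DirichletCharacter ℂ p) :
    ∑ g, irr none g * irr (some χ) g = 0 := by
  rw [sum_irr_none_mul]
  simpa [irr] using sum_irr_none_shift (p := p)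

lemma isCharacterTable_irr : IsCharacterTable (irr (p := p)) where
  isCharacter := isCharacter_irr
  orthonormal i j := by
    rw [card_eq]
    rcases i with _ | χ <;> rcases j with _ | ψ
    · have h (b : ZMod p) : irr none ⟨1, b⟩ * irr none ⟨1, b⟩ =
          (if b = 0 then (p : ℂ) * (p - 2) else 0) + 1 := by
        rw [irr, if_pos rfl]
        split_ifs <;> ring
      simp_rw [irr_none_inv, sum_irr_none_mul, h, Finset.sum_add_distrib]
      simp
      ring
    · rw [if_neg (by simp), ← Equiv.sum_comp (Equiv.inv _)]
      simpa [irr_none_inv] using sum_irr_none_mul_irr_some ψ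
    · simpa [irr_none_inv, mul_comm] using sum_irr_none_mul_irr_some χ
    · have h := sum_zmod_eq (χ * ψ⁻¹ : DirichletCharacter ℂ p)
      rw [MulChar.map_zero, zero_add] at h
      have hsum : ∑ g, irr (some χ) g * irr (some ψ) g⁻¹ =
          (∑ a, (χ * ψ⁻¹ : DirichletCharacter ℂ p) a) * p := by
        rw [sum_eq, h, Finset.sum_mul]
        refine Finset.sum_congr rfl fun a _ => ?_
        simp [irr, MulChar.inv_apply', mul_comm, -ZMod.inv_coe_unit]
      rw [hsum]
      simp only [Option.some.injEq]
      split_ifs with hχψ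
      · rw [h, hχψ, mul_inv_cancel]
        simp [MulChar.one_apply_coe, Nat.totient_prime Fact.out, (Fact.out : p.Prime).one_le]
      · rw [MulChar.sum_eq_zero_of_ne_one (mul_inv_eq_one.not.mpr hχψ), zero_mul]
  regular g := by
    rw [card_eq, Fintype.sum_option]
    have h := DirichletCharacter.sum_characters_eq ℂ (g.scale : ZMod p)
    rw [Nat.totient_prime Fact.out, Nat.cast_pred (Fact.out : p.Prime).pos] at h
    simp only [irr, scale_one, shift_one, if_true, Units.val_one, map_one, one_mul]
    rw [h]
    simp only [AffineGroup.ext_iff, scale_one, shift_one, Units.val_eq_one]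
    by_cases h₁ : g.scale = 1 <;> by_cases h₂ : g.shift = 0 <;> simp [h₁, h₂]
    ring

/-- The affine group of `ZMod p` has few zeros in its character table, but some if `2 < p`. -/
lemma zIG_mem_Ioc (hp : 2 < p) : zIG (AffineGroup (ZMod p)) ∈ Set.Ioc (0 : ℝ) (1 / p) := by
  have hcard : Nat.card (Option (DirichletCharacter ℂ p)) = p := by
    rw [Finite.card_option, DirichletCharacter.card_eq_totient_of_hasEnoughRootsOfUnity,
      Nat.totient_prime Fact.out, Nat.sub_add_cancel (Fact.out : p.Prime).one_le]
  have hG : (0 : ℝ) < Nat.card (AffineGroup (ZMod p)) := by exact_mod_cast Nat.card_pos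
  have hp₀ : (0 : ℝ) < p := by exact_mod_cast (Fact.out : p.Prime).pos
  rw [isCharacterTable_irr.zIG_eq, hcard]
  set Z := {x : Option (DirichletCharacter ℂ p) × AffineGroup (ZMod p) | irr x.1 x.2 = 0}
  constructor
  · have hunits : Nontrivial (ZMod p)ˣ := by
      rw [← Fintype.one_lt_card_iff_nontrivial, ZMod.card_units]
      lia
    obtain ⟨a, ha⟩ := exists_ne (1 : (ZMod p)ˣ)
    have : Nonempty Z := ⟨⟨(none, ⟨a, 0⟩), irr_none_of_scale_ne_one ha⟩⟩
    have : (0 : ℝ) < Nat.card Z := by exact_mod_cast Nat.card_pos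
    positivity
  · have hZ : Nat.card Z ≤ Nat.card (AffineGroup (ZMod p)) := by
      refine Nat.card_le_card_of_injective (fun x => x.1.2) ?_
      have hnone (x : Z) : x.1.1 = none := by
        obtain ⟨⟨_ | χ, g⟩, hx⟩ := x
        · rfl
        · exact absurd hx (g.scale.isUnit.map χ).ne_zero
      exact fun x y hxy => Subtype.ext (Prod.ext ((hnone x).trans (hnone y).symm) hxy)
    rw [div_le_div_iff₀ (by positivity) hp₀, one_mul, mul_comm]
    gcongr

end AffineGroup

/-- Denseness of values of `zIG` on finite groups. -/
theorem denseness_zI_group (L : ℝ) (hL1 : 0 ≤ L) (hL2 : L ≤ 1) (ε : ℝ) (hε : 0 < ε) :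
    ∃ (G : Type) (_ : Group G) (_ : Fintype G), |zIG G - L| < ε := by
  obtain ⟨p, hpN, hp⟩ := Nat.exists_infinite_primes (max 3 (⌈1 / ε⌉₊ + 2))
  have : Fact p.Prime := ⟨hp⟩
  have hp3 : 2 < p := (le_max_left _ _).trans hpN
  have hpε : 1 / ε + 2 ≤ (p : ℝ) := by
    have : ⌈1 / ε⌉₊ + 2 ≤ p := (le_max_right _ _).trans hpN
    have h : ((⌈1 / ε⌉₊ + 2 : ℕ) : ℝ) ≤ p := by exact_mod_cast this
    push_cast at h
    linarith [Nat.le_ceil (1 / ε)]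
  obtain ⟨hpos, hle⟩ := AffineGroup.zIG_mem_Ioc hp3
  have hp3' : (3 : ℝ) ≤ p := by exact_mod_cast hp3
  set z := zIG (AffineGroup (ZMod p))
  have hz₁ : z < 1 := by
    refine hle.trans_lt ?_
    rw [div_lt_one] <;> linarith
  have hzε : z < ε := by
    refine hle.trans_lt ?_
    rw [div_lt_comm₀] <;> linarith
  suffices ∃ n : ℕ, |(1 - z) ^ n - (1 - L)| < ε by
    obtain ⟨n, hn⟩ := this
    obtain ⟨K, _, _, -, -, -, -, -, hK⟩ :=
      AffineGroup.isCharacterTable_irr (p := p).exists_one_sub_zIG_eq_pow n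
    refine ⟨K, inferInstance, inferInstance, ?_⟩
    rw [← hK] at hn
    rw [abs_lt] at hn ⊢
    constructor <;> linarith
  rcases hL2.eq_or_lt with rfl | hL
  · obtain ⟨n, hn⟩ := exists_pow_lt_of_lt_one hε (show 1 - z < 1 by linarith)
    refine ⟨n, ?_⟩
    rwa [sub_self, sub_zero, abs_of_nonneg (pow_nonneg (by linarith) n)]
  · obtain ⟨n, hn₁, hn₂⟩ := exists_nat_pow_near_of_lt_one (sub_pos.mpr hL)
      (show 1 - L ≤ 1 by linarith) (show 0 < 1 - z by linarith) (show 1 - z < 1 by linarith)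
    refine ⟨n, ?_⟩
    have hpow : (1 - z) ^ n ≤ 1 := pow_le_one₀ (by linarith) (by linarith)
    rw [abs_of_nonneg (by linarith)]
    rw [pow_succ] at hn₁
    nlinarith
end
end

section
/- For any real number L with 0 ≤ L ≤ 1 and any ε > 0, there exists a finite group G such that |u_II(G) − L| < ε. -/
open scoped Classical

noncomputable section

open CategoryTheory in
/-- Schur's lemma: an endomorphism commuting with an irreducible representation is a scalar. -/
theorem FDRep.exists_eq_smul_id_of_commute {G : Type} [Group G] (V : FDRep ℂ G) [Simple V]
    (f : V →ₗ[ℂ] V) (hf : ∀ g, f ∘ₗ V.ρ g = V.ρ g ∘ₗ f) : ∃ c : ℂ, f = c • LinearMap.id := by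
  let F : V ⟶ V := ⟨InducedCategory.homMk (ModuleCat.ofHom f), fun g => by
    ext x
    exact LinearMap.congr_fun (hf g) x⟩
  obtain ⟨c, hc⟩ := (finrank_eq_one_iff_of_nonzero' (𝟙 V) (id_nonzero V)).mp
    (finrank_endomorphism_simple_eq_one ℂ V) F
  refine ⟨c, ?_⟩
  ext x
  have := congrArg (fun φ : V ⟶ V => (φ.hom.hom.hom : V →ₗ[ℂ] V) x) hc
  exact this.symm

open CategoryTheory in
theorem FDRep.finrank_pos_of_simple {G : Type} [Group G] (V : FDRep ℂ G) [Simple V] :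
    0 < Module.finrank ℂ V := by
  by_contra h
  have h0 : Module.finrank ℂ V = 0 := by omega
  have := Module.finrank_zero_iff.mp h0
  refine id_nonzero V ?_
  ext x
  exact Subsingleton.elim (α := V) _ _

theorem isIrredChar_of_norm_one {G : Type} [Group G] [Fintype G] {V : Type} [AddCommGroup V]
    [Module ℂ V] [FiniteDimensional ℂ V] (ρ : Representation ℂ G V)
    (h : ∑ g : G, ρ.character g * ρ.character g⁻¹ = Nat.card G) : IsIrredChar ρ.character :=
  ⟨FDRep.of ρ, (FDRep.simple_iff_char_is_norm_one _).mpr h, rfl⟩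

open CategoryTheory in
theorem FDRep.simple_of_isIrreducible {G : Type} [Group G] [Fintype G] {V : Type}
    [AddCommGroup V] [Module ℂ V] [FiniteDimensional ℂ V] (ρ : Representation ℂ G V)
    [ρ.IsIrreducible] : Simple (FDRep.of ρ) := by
  refine (FDRep.simple_iff_char_is_norm_one _).mpr ?_
  have := invertibleOfNonzero (NeZero.ne (Nat.card G : ℂ))
  have h := Representation.char_orthonormal ρ ρ
  rw [if_pos ⟨.refl ρ⟩, inv_mul_eq_one₀ (NeZero.ne _)] at h
  exact h.symm

theorem IsIrredChar.apply_conj {G : Type} [Group G] {χ : G → ℂ} (hχ : IsIrredChar χ) (g h : G) :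
    χ (h * g * h⁻¹) = χ g := by
  obtain ⟨V, -, rfl⟩ := hχ
  exact V.char_conj g h

theorem IsIrredChar.apply_eq_of_isConj {G : Type} [Group G] {χ : G → ℂ} (hχ : IsIrredChar χ)
    {g h : G} (hgh : IsConj g h) : χ g = χ h := by
  obtain ⟨c, rfl⟩ := isConj_iff.mp hgh
  exact (hχ.apply_conj g c).symm

theorem IsIrredChar.sum_mul_inv {G : Type} [Group G] [Fintype G] {χ ψ : G → ℂ}
    (hχ : IsIrredChar χ) (hψ : IsIrredChar ψ) (hne : χ ≠ ψ) : ∑ g : G, χ g * ψ g⁻¹ = 0 := by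
  obtain ⟨V, hV, rfl⟩ := hχ
  obtain ⟨W, hW, rfl⟩ := hψ
  have := invertibleOfNonzero (NeZero.ne (Nat.card G : ℂ))
  have h := FDRep.char_orthonormal V W
  rw [if_neg fun ⟨i⟩ => hne (FDRep.char_iso i)] at h
  exact (mul_eq_zero.mp h).resolve_left (inv_ne_zero (NeZero.ne _))

theorem IsIrredChar.sum_mul_inv_self {G : Type} [Group G] [Fintype G] {χ : G → ℂ}
    (hχ : IsIrredChar χ) : ∑ g : G, χ g * χ g⁻¹ = Nat.card G := by
  obtain ⟨V, hV, rfl⟩ := hχ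
  exact (FDRep.simple_iff_char_is_norm_one V).mp hV

open CategoryTheory in
open scoped MonoidAlgebra in
/-- A class function orthogonal to an irreducible character acts as zero on the
corresponding representation. -/
theorem FDRep.asAlgebraHom_sum_single_eq_zero {G : Type} [Group G] [Fintype G] (f : G → ℂ)
    (hf : ∀ g h, f (h * g * h⁻¹) = f g) (V : FDRep ℂ G) [Simple V]
    (h0 : ∑ g, f g * V.character g = 0) :
    Representation.asAlgebraHom V.ρ (∑ g, MonoidAlgebra.single g (f g)) = 0 := by
  have hsum : Representation.asAlgebraHom V.ρ (∑ g, MonoidAlgebra.single g (f g)) =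
      ∑ g, f g • V.ρ g := by
    rw [map_sum]
    exact Finset.sum_congr rfl fun g _ => Representation.asAlgebraHom_single V.ρ g (f g)
  obtain ⟨c, hc⟩ := V.exists_eq_smul_id_of_commute (∑ g, f g • V.ρ g) fun h => by
    change (∑ g, f g • V.ρ g) * V.ρ h = V.ρ h * ∑ g, f g • V.ρ g
    rw [Finset.sum_mul, Finset.mul_sum, ← Equiv.sum_comp (MulAut.conj h).toEquiv]
    refine Finset.sum_congr rfl fun g _ => ?_
    simp only [smul_mul_assoc, mul_smul_comm, ← map_mul]
    have hc : (MulAut.conj h).toEquiv g = h * g * h⁻¹ := rfl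
    rw [hc, hf, inv_mul_cancel_right]
  have htr : c * Module.finrank ℂ V = 0 := by
    rw [← h0, ← smul_eq_mul, ← LinearMap.trace_id, ← map_smul, ← hc, map_sum]
    exact Finset.sum_congr rfl fun g _ => map_smul _ _ _
  have hc0 : c = 0 := (mul_eq_zero.mp htr).resolve_right
    (Nat.cast_ne_zero.mpr V.finrank_pos_of_simple.ne')
  rw [hsum, hc, hc0, zero_smul]

open scoped MonoidAlgebra in
theorem sum_single_smul_eq_zero {G : Type} [Group G] [Fintype G] (f : G → ℂ)
    (hf : ∀ g h, f (h * g * h⁻¹) = f g)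
    (h0 : ∀ χ : G → ℂ, IsIrredChar χ → ∑ g, f g * χ g = 0)
    {M : Type} [AddCommGroup M] [Module ℂ M] [Module ℂ[G] M] [IsScalarTower ℂ ℂ[G] M]
    [FiniteDimensional ℂ M] [IsSimpleModule ℂ[G] M]
    (m : M) : (∑ g, MonoidAlgebra.single g (f g) : ℂ[G]) • m = 0 := by
  let ρ : Representation ℂ G M := Representation.ofModule' M
  have hρ (r : ℂ[G]) (x : M) : ρ.asAlgebraHom r x = r • x :=
    LinearMap.congr_fun (DFunLike.congr_fun
      ((MonoidAlgebra.lift ℂ (M →ₗ[ℂ] M) G).apply_symm_apply (Algebra.lsmul ℂ ℂ M)) r) x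
  let e : ρ.asModule ≃ₗ[ℂ[G]] M :=
    { ρ.asModuleEquiv.toAddEquiv with
      map_smul' := fun r x => (ρ.asModuleEquiv_map_smul r x).trans (hρ r _) }
  have : ρ.IsIrreducible :=
    (Representation.irreducible_iff_isSimpleModule_asModule ρ).mpr (IsSimpleModule.congr e)
  have hV := FDRep.simple_of_isIrreducible ρ
  have hact := FDRep.asAlgebraHom_sum_single_eq_zero f hf (FDRep.of ρ) (h0 _ ⟨_, hV, rfl⟩)
  rw [← hρ]
  exact LinearMap.congr_fun hact m

open scoped MonoidAlgebra in
/-- A class function orthogonal to all irreducible characters vanishes. -/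
theorem eq_zero_of_forall_sum_mul_irredChar_eq_zero {G : Type} [Group G] [Fintype G] (f : G → ℂ)
    (hf : ∀ g h, f (h * g * h⁻¹) = f g)
    (h0 : ∀ χ : G → ℂ, IsIrredChar χ → ∑ g, f g * χ g = 0) : f = 0 := by
  let z : ℂ[G] := ∑ g, MonoidAlgebra.single g (f g)
  have hz : z ∈ Ring.jacobson ℂ[G] := by
    rw [Ring.jacobson_eq_sInf_isMaximal, Submodule.mem_sInf]
    intro I hI
    have : IsSimpleModule ℂ[G] (ℂ[G] ⧸ I) :=
      isSimpleModule_iff_isCoatom.mpr (Ideal.isMaximal_def.mp hI)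
    have hact : z • (Submodule.Quotient.mk 1 : ℂ[G] ⧸ I) = 0 := sum_single_smul_eq_zero f hf h0 _
    rwa [← Submodule.Quotient.mk_smul, smul_eq_mul, mul_one,
      Submodule.Quotient.mk_eq_zero] at hact
  rw [IsSemisimpleRing.jacobson_eq_bot, Submodule.mem_bot] at hz
  funext g
  have := congrArg (fun x : ℂ[G] => x.coeff g) hz
  simpa [z, Finsupp.single_apply] using this

/-- An irreducible character as a function on conjugacy classes. -/
def irredCharOnClasses {G : Type} [Group G] (χ : {χ : G → ℂ | IsIrredChar χ}) :
    ConjClasses G → ℂ :=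
  Quotient.lift χ.1 fun _ _ h => χ.2.apply_eq_of_isConj h

theorem linearIndependent_irredCharOnClasses {G : Type} [Group G] [Fintype G] :
    LinearIndependent ℂ (irredCharOnClasses (G := G)) := by
  rw [linearIndependent_iff']
  intro s c hc ψ hψ
  have hval (g : G) : ∑ χ ∈ s, c χ * χ.1 g = 0 := by
    have := congrFun hc (ConjClasses.mk g)
    rwa [Finset.sum_apply] at this
  have hsum : ∑ χ ∈ s, c χ * ∑ g, χ.1 g * ψ.1 g⁻¹ = 0 := by
    simp only [Finset.mul_sum]
    rw [Finset.sum_comm]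
    refine Finset.sum_eq_zero fun g _ => ?_
    rw [← zero_mul (ψ.1 g⁻¹), ← hval g, Finset.sum_mul]
    exact Finset.sum_congr rfl fun χ _ => (mul_assoc _ _ _).symm
  rw [Finset.sum_eq_single_of_mem ψ hψ, ψ.2.sum_mul_inv_self] at hsum
  · exact (mul_eq_zero.mp hsum).resolve_right (NeZero.ne _)
  · intro χ _ hne
    rw [χ.2.sum_mul_inv ψ.2 (Subtype.coe_injective.ne hne), mul_zero]

theorem span_irredCharOnClasses {G : Type} [Group G] [Fintype G] :
    Submodule.span ℂ (Set.range (irredCharOnClasses (G := G))) = ⊤ := by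
  by_contra hne
  obtain ⟨φ, hφ0, hφ⟩ := Submodule.exists_le_ker_of_lt_top _ (lt_top_iff_ne_top.mpr hne)
  have hcard (C : ConjClasses G) :
      ((Finset.univ.filter fun g => ConjClasses.mk g = C).card : ℂ) ≠ 0 := by
    obtain ⟨g, rfl⟩ := C.exists_rep
    exact Nat.cast_ne_zero.mpr (Finset.card_ne_zero_of_mem
      (Finset.mem_filter.mpr ⟨Finset.mem_univ g, rfl⟩))
  let f (C : ConjClasses G) : ℂ :=
    φ (Pi.single C 1) / (Finset.univ.filter fun g => ConjClasses.mk g = C).card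
  have hsum (h : ConjClasses G → ℂ) :
      ∑ g : G, f (ConjClasses.mk g) * h (ConjClasses.mk g) = φ h := by
    rw [← Finset.sum_fiberwise Finset.univ (ConjClasses.mk (α := G))]
    conv_rhs => rw [LinearMap.pi_apply_eq_sum_univ φ h]
    refine Finset.sum_congr rfl fun C _ => ?_
    rw [Finset.sum_congr rfl (g := fun _ => f C * h C) fun g hg => by
      rw [(Finset.mem_filter.mp hg).2], Finset.sum_const, nsmul_eq_mul, smul_eq_mul]
    have := hcard C
    have hs : (Pi.single C 1 : ConjClasses G → ℂ) = fun j => if C = j then 1 else 0 := by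
      funext j
      simp [Pi.single_apply, eq_comm]
    rw [← hs]
    simp only [f]
    field_simp
  have hzero := eq_zero_of_forall_sum_mul_irredChar_eq_zero (fun g : G => f (ConjClasses.mk g))
    (fun g h => congrArg f (ConjClasses.mk_eq_mk_iff_isConj.mpr
      (isConj_iff.mpr ⟨h, rfl⟩).symm))
    fun χ hχ => (hsum (irredCharOnClasses ⟨χ, hχ⟩)).trans
      (hφ (Submodule.subset_span ⟨⟨χ, hχ⟩, rfl⟩))
  refine hφ0 (LinearMap.ext fun h => ?_)
  rw [← hsum h]
  exact Finset.sum_eq_zero fun g _ => by rw [congrFun hzero g, Pi.zero_apply, zero_mul]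

/-- The number of irreducible characters is the number of conjugacy classes. -/
theorem card_isIrredChar {G : Type} [Group G] [Fintype G] :
    Nat.card {χ : G → ℂ | IsIrredChar χ} = Nat.card (ConjClasses G) := by
  rw [← Module.finrank_eq_nat_card_basis (Module.Basis.mk linearIndependent_irredCharOnClasses
    span_irredCharOnClasses.ge), Module.finrank_pi, Nat.card_eq_fintype_card]

theorem isRootOfUnity_coe_monoidHom {G : Type} [Group G] [Fintype G] (φ : G →* ℂˣ) (g : G) :
    IsRootOfUnity (φ g) := by
  refine ⟨Fintype.card G, Fintype.card_pos, ?_⟩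
  rw [← Units.val_pow_eq_pow_val, ← map_pow, pow_card_eq_one, map_one, Units.val_one]

theorem isIrredChar_coe_monoidHom {G : Type} [Group G] [Fintype G] (φ : G →* ℂˣ) :
    IsIrredChar fun g => (φ g : ℂ) := by
  let ρ : Representation ℂ G ℂ :=
    (Algebra.lsmul ℂ ℂ ℂ : ℂ →ₐ[ℂ] Module.End ℂ ℂ).toMonoidHom.comp ((Units.coeHom ℂ).comp φ)
  have hρ : ρ.character = fun g => (φ g : ℂ) := by
    funext g
    have : ρ g = (φ g : ℂ) • LinearMap.id := by
      ext
      simp [ρ]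
    rw [Representation.character, this, map_smul, LinearMap.trace_id]
    simp
  rw [← hρ]
  refine isIrredChar_of_norm_one ρ ?_
  simp [hρ]

theorem exists_monoidHom_of_apply_one {G : Type} [Group G] {χ : G → ℂ} (hχ : IsIrredChar χ)
    (h1 : χ 1 = 1) : ∃ φ : G →* ℂˣ, (fun g => (φ g : ℂ)) = χ := by
  obtain ⟨V, -, rfl⟩ := hχ
  rw [FDRep.char_one, Nat.cast_eq_one] at h1
  have hsc (g : G) : V.ρ g = V.character g • LinearMap.id := by
    obtain ⟨c, hc⟩ : ∃ c : ℂ, c • LinearMap.id = V.ρ g :=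
      (finrank_eq_one_iff_of_nonzero' (LinearMap.id : V →ₗ[ℂ] V) (by
        intro h0
        have := congrArg (LinearMap.trace ℂ V) h0
        simp [h1] at this)).mp (by rw [Module.finrank_linearMap, h1]) (V.ρ g)
    have : V.character g = c := by
      rw [FDRep.character, ← hc, map_smul, LinearMap.trace_id, h1]
      simp
    rw [this, hc]
  let ψ : G →* ℂ :=
    { toFun := V.character
      map_one' := by rw [FDRep.char_one, h1, Nat.cast_one]
      map_mul' := fun g h => by
        rw [FDRep.character, map_mul, hsc g, smul_mul_assoc, map_smul, smul_eq_mul]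
        rfl }
  exact ⟨ψ.toHomUnits, funext fun g => ψ.coe_toHomUnits g⟩

/-- The linear characters are counted by the abelianization. -/
theorem card_linear_isIrredChar {G : Type} [Group G] [Fintype G] :
    Nat.card {χ : G → ℂ | IsIrredChar χ ∧ χ 1 = 1} = (commutator G).index := by
  have e : (G →* ℂˣ) ≃ {χ : G → ℂ | IsIrredChar χ ∧ χ 1 = 1} :=
    Equiv.ofBijective (fun φ => ⟨fun g => φ g, isIrredChar_coe_monoidHom φ, by simp⟩)
      ⟨fun φ ψ h => MonoidHom.ext fun g => Units.ext (congrFun (congrArg Subtype.val h) g),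
        fun χ => by
          obtain ⟨φ, hφ⟩ := exists_monoidHom_of_apply_one χ.2.1 χ.2.2
          exact ⟨φ, Subtype.ext hφ⟩⟩
  have : Finite (Abelianization G) := Quotient.finite _
  rw [← Nat.card_congr e, Nat.card_congr (Abelianization.lift (G := G) (A := ℂˣ)),
    CommGroup.card_monoidHom_of_hasEnoughRootsOfUnity]
  rfl

open scoped commutatorElement in
/-- In a group of class at most two, an irreducible character taking a root of unity as a value
is linear. -/
theorem IsIrredChar.apply_one_of_isRootOfUnity {G : Type} [Group G] [Fintype G]
    (hG : commutator G ≤ Subgroup.center G) {χ : G → ℂ} (hχ : IsIrredChar χ) {g : G}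
    (hg : IsRootOfUnity (χ g)) : χ 1 = 1 := by
  obtain ⟨V, hV, rfl⟩ := hχ
  obtain ⟨k, hk, hpow⟩ := hg
  have hg0 : V.character g ≠ 0 := by
    intro h0
    rw [h0, zero_pow hk.ne'] at hpow
    exact zero_ne_one hpow
  have hcomm (h : G) : V.ρ h * V.ρ g = V.ρ g * V.ρ h := by
    obtain ⟨c, hc⟩ := V.exists_eq_smul_id_of_commute (V.ρ ⁅h, g⁆) fun x => by
      have := Subgroup.mem_center_iff.mp
        (hG (Subgroup.commutator_mem_commutator (Subgroup.mem_top h) (Subgroup.mem_top g))) x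
      change V.ρ _ * V.ρ x = V.ρ x * V.ρ _
      rw [← map_mul, ← map_mul, this]
    have hmul : h * g * h⁻¹ = ⁅h, g⁆ * g := by
      rw [commutatorElement_def, inv_mul_cancel_right]
    have hχ : V.character g = c * V.character g := by
      conv_lhs =>
        rw [← V.char_conj g h, hmul, FDRep.character, map_mul, hc, smul_mul_assoc, map_smul,
          smul_eq_mul]
      rfl
    rw [right_eq_mul₀ hg0] at hχ
    have hhg : h * g = ⁅h, g⁆ * (g * h) := by
      rw [← mul_assoc, ← hmul, inv_mul_cancel_right]
    rw [← map_mul, hhg, map_mul, hc, hχ, one_smul, ← map_mul]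
    rfl
  obtain ⟨a, ha⟩ := V.exists_eq_smul_id_of_commute (V.ρ g) fun h => (hcomm h).symm
  have hnt : Nontrivial V := Module.finrank_pos_iff.mp V.finrank_pos_of_simple
  have hapow : a ^ Fintype.card G = 1 := by
    have h1 : V.ρ g ^ Fintype.card G = 1 := by rw [← map_pow, pow_card_eq_one, map_one]
    rw [ha, ← Module.End.one_eq_id, smul_pow, one_pow] at h1
    exact smul_left_injective ℂ (one_ne_zero (α := Module.End ℂ V)) (h1.trans (one_smul ℂ _).symm)
  have hna : ‖a‖ = 1 := Complex.norm_eq_one_of_pow_eq_one hapow Fintype.card_ne_zero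
  have hnχ : ‖V.character g‖ = 1 := Complex.norm_eq_one_of_pow_eq_one hpow hk.ne'
  rw [FDRep.character, ha, map_smul, LinearMap.trace_id, smul_eq_mul, norm_mul, hna, one_mul,
    Complex.norm_natCast, Nat.cast_eq_one] at hnχ
  rw [FDRep.char_one, hnχ, Nat.cast_one]

/-- In a finite group of class at most two, the proportion `u_II` is the proportion of linear
characters. -/
theorem uIIG_eq_index_div_card {G : Type} [Group G] [Fintype G]
    (hG : commutator G ≤ Subgroup.center G) :
    uIIG G = (commutator G).index / Nat.card (ConjClasses G) := by
  have hset : {p : (G → ℂ) × ConjClasses G |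
      IsIrredChar p.1 ∧ ∃ g, ConjClasses.mk g = p.2 ∧ IsRootOfUnity (p.1 g)} =
      {χ : G → ℂ | IsIrredChar χ ∧ χ 1 = 1} ×ˢ Set.univ := by
    ext ⟨χ, C⟩
    simp only [Set.mem_ofPred_eq, Set.mem_prod, Set.mem_univ, and_true]
    refine and_congr_right fun hχ => ⟨?_, fun h1 => ?_⟩
    · rintro ⟨g, -, hg⟩
      exact hχ.apply_one_of_isRootOfUnity hG hg
    · obtain ⟨g, rfl⟩ := C.exists_rep
      obtain ⟨φ, rfl⟩ := exists_monoidHom_of_apply_one hχ h1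
      exact ⟨g, rfl, isRootOfUnity_coe_monoidHom φ g⟩
  have hcard : (Nat.card (ConjClasses G) : ℝ) ≠ 0 := Nat.cast_ne_zero.mpr Nat.card_pos.ne'
  rw [uIIG, hset, Nat.card_congr (Equiv.Set.prod _ _), Nat.card_prod, card_linear_isIrredChar,
    card_isIrredChar, Nat.card_univ, Nat.cast_mul, mul_div_mul_right _ _ hcard]

/-- The Heisenberg group over a ring `F`. -/
@[ext] structure HeisenbergGroup (F : Type) where
  /-- The upper left entry. -/
  a : F
  /-- The lower right entry. -/
  b : F
  /-- The corner entry. -/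
  c : F

namespace HeisenbergGroup

/-- The entries of an element of the Heisenberg group. -/
def equivProd (F : Type) : HeisenbergGroup F ≃ (F × F) × F where
  toFun x := ((x.a, x.b), x.c)
  invFun x := ⟨x.1.1, x.1.2, x.2⟩

instance (F : Type) [Fintype F] : Fintype (HeisenbergGroup F) :=
  Fintype.ofEquiv _ (equivProd F).symm

instance (F : Type) [CommRing F] : Mul (HeisenbergGroup F) :=
  ⟨fun x y => ⟨x.a + y.a, x.b + y.b, x.c + y.c + x.a * y.b⟩⟩

instance (F : Type) [CommRing F] : One (HeisenbergGroup F) := ⟨⟨0, 0, 0⟩⟩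

instance (F : Type) [CommRing F] : Inv (HeisenbergGroup F) :=
  ⟨fun x => ⟨-x.a, -x.b, -x.c + x.a * x.b⟩⟩

theorem card (F : Type) : Nat.card (HeisenbergGroup F) = Nat.card F ^ 3 := by
  rw [Nat.card_congr (equivProd F), Nat.card_prod, Nat.card_prod]
  ring

section Ring

variable {F : Type} [CommRing F]

theorem mul_def (x y : HeisenbergGroup F) :
    x * y = ⟨x.a + y.a, x.b + y.b, x.c + y.c + x.a * y.b⟩ := rfl

theorem one_def : (1 : HeisenbergGroup F) = ⟨0, 0, 0⟩ := rfl

theorem inv_def (x : HeisenbergGroup F) : x⁻¹ = ⟨-x.a, -x.b, -x.c + x.a * x.b⟩ := rfl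

instance : Group (HeisenbergGroup F) where
  mul_assoc x y z := by
    ext <;> simp only [mul_def] <;> ring
  one_mul x := by
    ext <;> simp [mul_def, one_def]
  mul_one x := by
    ext <;> simp [mul_def, one_def]
  inv_mul_cancel x := by
    ext <;> simp [mul_def, one_def, inv_def]

theorem commute_iff (x y : HeisenbergGroup F) : Commute x y ↔ x.a * y.b = y.a * x.b := by
  rw [commute_iff_eq, HeisenbergGroup.ext_iff]
  simp only [mul_def]
  rw [add_comm x.a, add_comm x.b, add_comm x.c]
  simp

/-- The projection of the Heisenberg group onto its abelianization. -/
def toProd (F : Type) [CommRing F] : HeisenbergGroup F →* Multiplicative (F × F) where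
  toFun x := Multiplicative.ofAdd (x.a, x.b)
  map_one' := rfl
  map_mul' _ _ := rfl

theorem mem_ker_toProd {x : HeisenbergGroup F} : x ∈ (toProd F).ker ↔ x.a = 0 ∧ x.b = 0 := by
  rw [MonoidHom.mem_ker]
  exact Prod.ext_iff

open scoped commutatorElement in
theorem commutator_eq_ker : commutator (HeisenbergGroup F) = (toProd F).ker := by
  refine le_antisymm (Abelianization.commutator_subset_ker _) fun x hx => ?_
  obtain ⟨ha, hb⟩ := mem_ker_toProd.mp hx
  have hx : x = ⁅(⟨1, 0, 0⟩ : HeisenbergGroup F), ⟨0, x.c, 0⟩⁆ := by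
    ext <;> simp [commutatorElement_def, mul_def, inv_def, ha, hb]
  rw [hx]
  exact Subgroup.commutator_mem_commutator (Subgroup.mem_top _) (Subgroup.mem_top _)

theorem commutator_le_center :
    commutator (HeisenbergGroup F) ≤ Subgroup.center (HeisenbergGroup F) := by
  rw [commutator_eq_ker]
  intro x hx
  obtain ⟨ha, hb⟩ := mem_ker_toProd.mp hx
  refine Subgroup.mem_center_iff.mpr fun y => ((commute_iff y x).mpr ?_).eq
  rw [ha, hb, mul_zero, zero_mul]

theorem index_commutator : (commutator (HeisenbergGroup F)).index = Nat.card F ^ 2 := by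
  have hsurj : Function.Surjective (toProd F) := fun y => ⟨⟨y.toAdd.1, y.toAdd.2, 0⟩, rfl⟩
  rw [commutator_eq_ker, Subgroup.index_ker, MonoidHom.range_eq_top.mpr hsurj,
    Subgroup.card_top, Nat.card_congr Multiplicative.toAdd, Nat.card_prod, sq]

end Ring

section Field

variable {F : Type} [Field F]

theorem card_proportional {x : F × F} (hx : x ≠ 0) :
    Nat.card {y : F × F // x.1 * y.2 = y.1 * x.2} = Nat.card F := by
  refine (Nat.card_congr (Equiv.ofBijective
    (fun t : F => ⟨t • x, by simp only [Prod.smul_fst, Prod.smul_snd, smul_eq_mul]; ring⟩)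
    ⟨fun s t h => smul_left_injective F hx (congrArg Subtype.val h), ?_⟩)).symm
  rintro ⟨⟨y₁, y₂⟩, hy⟩
  obtain ⟨x₁, x₂⟩ := x
  simp only at hy
  by_cases h1 : x₁ = 0
  · have h2 : x₂ ≠ 0 := fun h2 => hx (by rw [h1, h2]; rfl)
    have hy₁ : y₁ = 0 := by simpa [h1, h2] using hy
    refine ⟨y₂ / x₂, Subtype.ext (Prod.ext ?_ ?_)⟩
    · simp [h1, hy₁]
    · simp [h2]
  · refine ⟨y₁ / x₁, Subtype.ext (Prod.ext ?_ ?_)⟩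
    · simp [h1]
    · simp only [Prod.smul_snd, smul_eq_mul]
      field_simp
      exact hy.symm

theorem card_conjClasses [Fintype F] :
    (Nat.card (ConjClasses (HeisenbergGroup F)) : ℝ) = (Nat.card F : ℝ) ^ 2 + Nat.card F - 1 := by
  have hpairs : Nat.card {p : HeisenbergGroup F × HeisenbergGroup F // Commute p.1 p.2} =
      Nat.card F ^ 2 * ∑ x : F × F, Nat.card {y : F × F // x.1 * y.2 = y.1 * x.2} := by
    let e : {p : HeisenbergGroup F × HeisenbergGroup F // Commute p.1 p.2} ≃
        (F × F) × (Σ x : F × F, {y : F × F // x.1 * y.2 = y.1 * x.2}) :=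
      { toFun := fun p => ((p.1.1.c, p.1.2.c),
          ⟨(p.1.1.a, p.1.1.b), ⟨(p.1.2.a, p.1.2.b), (commute_iff _ _).mp p.2⟩⟩)
        invFun := fun q => ⟨(⟨q.2.1.1, q.2.1.2, q.1.1⟩, ⟨q.2.2.1.1, q.2.2.1.2, q.1.2⟩),
          (commute_iff _ _).mpr q.2.2.2⟩ }
    rw [Nat.card_congr e, Nat.card_prod, Nat.card_prod, Nat.card_sigma, sq]
  have hsum : (∑ x : F × F, Nat.card {y : F × F // x.1 * y.2 = y.1 * x.2} : ℝ) =
      (Nat.card F : ℝ) ^ 2 + ((Nat.card F : ℝ) ^ 2 - 1) * Nat.card F := by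
    rw [← Finset.add_sum_erase _ _ (Finset.mem_univ (0 : F × F)), Finset.sum_congr rfl
      (g := fun _ => (Nat.card F : ℝ)) fun x hx => by
        rw [card_proportional (Finset.ne_of_mem_erase hx)], Finset.sum_const,
      Finset.card_erase_of_mem (Finset.mem_univ _), Finset.card_univ, nsmul_eq_mul,
      Nat.cast_sub Fintype.card_pos]
    simp [sq]
  have h := card_comm_eq_card_conjClasses_mul_card (HeisenbergGroup F)
  rw [hpairs, card] at h
  have hR := congrArg (Nat.cast (R := ℝ)) h
  push_cast at hR
  rw [hsum] at hR
  have hF : (Nat.card F : ℝ) ≠ 0 := Nat.cast_ne_zero.mpr Nat.card_pos.ne'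
  refine mul_right_cancel₀ (pow_ne_zero 3 hF) (hR.symm.trans ?_)
  ring

end Field

end HeisenbergGroup

theorem commutator_pi_const {ι E : Type} [Finite ι] [Group E] :
    commutator (ι → E) = Subgroup.pi Set.univ fun _ => commutator E := by
  rw [commutator_def, commutator_def, ← Subgroup.commutator_pi_pi_of_finite, Subgroup.pi_top]

theorem commutator_pi_le_center {ι E : Type} [Finite ι] [Group E]
    (hE : commutator E ≤ Subgroup.center E) :
    commutator (ι → E) ≤ Subgroup.center (ι → E) := by
  rw [commutator_pi_const]
  exact fun x hx => Subgroup.mem_center_iff.mpr fun y => funext fun i =>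
    Subgroup.mem_center_iff.mp (hE (hx i (Set.mem_univ i))) (y i)

theorem index_commutator_pi {ι E : Type} [Fintype ι] [Group E] [Finite E] :
    (commutator (ι → E)).index = (commutator E).index ^ Fintype.card ι := by
  have hcard : Nat.card (commutator (ι → E)) = Nat.card (commutator E) ^ Fintype.card ι := by
    rw [commutator_pi_const, ← Nat.card_eq_fintype_card, ← Nat.card_fun]
    exact Nat.card_congr
      { toFun := fun x i => ⟨x.1 i, x.2 i (Set.mem_univ i)⟩
        invFun := fun x => ⟨fun i => x i, fun i _ => (x i).2⟩ }
  have h := (commutator (ι → E)).card_mul_index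
  rw [hcard, Nat.card_fun, ← (commutator E).card_mul_index, mul_pow, Nat.card_eq_fintype_card (α := ι)] at h
  exact Nat.eq_of_mul_eq_mul_left (pow_pos Nat.card_pos _) h

theorem card_conjClasses_pi {ι E : Type} [Fintype ι] [Group E] [Finite E] :
    Nat.card (ConjClasses (ι → E)) = Nat.card (ConjClasses E) ^ Fintype.card ι := by
  have h := commProb_function (α := ι) (β := E)
  have hE : (Nat.card E : ℚ) ≠ 0 := Nat.cast_ne_zero.mpr Nat.card_pos.ne'
  rw [commProb_def', commProb_def', div_pow, Nat.card_fun, Nat.card_eq_fintype_card (α := ι),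
    Nat.cast_pow, div_left_inj' (pow_ne_zero _ hE)] at h
  exact_mod_cast h

/-- For a finite group `E` of class at most two, the value of `u_II` at `E ^ m` is the `m`-th
power of the proportion of linear characters of `E`. -/
theorem uIIG_pi {ι E : Type} [Fintype ι] [Group E] [Fintype E]
    (hE : commutator E ≤ Subgroup.center E) :
    uIIG (ι → E) =
      ((commutator E).index / Nat.card (ConjClasses E) : ℝ) ^ Fintype.card ι := by
  rw [uIIG_eq_index_div_card (commutator_pi_le_center hE), index_commutator_pi,
    card_conjClasses_pi, Nat.cast_pow, Nat.cast_pow, div_pow]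

theorem exists_pow_abs_sub_lt {r L ε : ℝ} (hr0 : 0 < r) (hr1 : r < 1) (hrε : 1 - r < ε)
    (hL0 : 0 ≤ L) (hL1 : L ≤ 1) : ∃ m : ℕ, |r ^ m - L| < ε := by
  rcases hL0.eq_or_lt with rfl | hL
  · obtain ⟨m, hm⟩ := exists_pow_lt_of_lt_one ((sub_pos.mpr hr1).trans hrε) hr1
    exact ⟨m, by rwa [sub_zero, abs_of_pos (pow_pos hr0 m)]⟩
  · obtain ⟨m, hlt, hle⟩ := exists_nat_pow_near_of_lt_one hL hL1 hr0 hr1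
    refine ⟨m, ?_⟩
    rw [abs_of_nonneg (sub_nonneg.mpr hle)]
    have h1 : r ^ m ≤ 1 := pow_le_one₀ hr0.le hr1.le
    have h2 : r ^ m * (1 - r) ≤ 1 - r := mul_le_of_le_one_left (sub_pos.mpr hr1).le h1
    rw [pow_succ] at hlt
    linarith

/-- Denseness of values of `uIIG` on finite groups. -/
theorem denseness_uII_group (L : ℝ) (hL1 : 0 ≤ L) (hL2 : L ≤ 1) (ε : ℝ) (hε : 0 < ε) :
    ∃ (G : Type) (_ : Group G) (_ : Fintype G), |uIIG G - L| < ε := by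
  obtain ⟨n, hn⟩ := exists_nat_gt ε⁻¹
  obtain ⟨p, hnp, hp⟩ := Nat.exists_infinite_primes n
  have : Fact p.Prime := ⟨hp⟩
  have hp2 : (2 : ℝ) ≤ p := Nat.ofNat_le_cast.mpr hp.two_le
  have hεp : 1 < ε * p := by
    rw [← inv_lt_iff_one_lt_mul₀' hε]
    exact hn.trans_le (Nat.cast_le.mpr hnp)
  have hden : 0 < (p : ℝ) ^ 2 + p - 1 := by nlinarith
  obtain ⟨m, hm⟩ := exists_pow_abs_sub_lt (ε := ε)
    (r := (p : ℝ) ^ 2 / ((p : ℝ) ^ 2 + p - 1))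
    (by positivity) (by rw [div_lt_one hden]; linarith)
    (by rw [one_sub_div hden.ne', div_lt_iff₀ hden]; nlinarith) hL1 hL2
  refine ⟨Fin m → HeisenbergGroup (ZMod p), inferInstance, inferInstance, ?_⟩
  rwa [uIIG_pi HeisenbergGroup.commutator_le_center, HeisenbergGroup.index_commutator,
    HeisenbergGroup.card_conjClasses, Nat.card_zmod, Nat.cast_pow, Fintype.card_fin]
end
end
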